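/- Let I be a p_F-primary monomial ideal in k[ℕA]. Then I is irreducible (i.e., I is a proper ideal and whenever I = J ∩ K for ideals J, K of k[ℕA], either I = J or I = K) if and only if the standard pairs of I whose overlap class is maximal with respect to divisibility form a single overlap class. -/

import Mathlib

open scoped BigOperators

namespace StdPairsPaper

/-- The coercion of a lattice point to a real vector. -/
def toR {d : ℕ} (v : Fin d → ℤ) : Fin d → ℝ := fun i => (v i : ℝ)

/-- The cone of nonnegative real combinations of (the real images of) elements of `S`. -/
def cone {d : ℕ} (S : Set (Fin d → ℤ)) : Set (Fin d → ℝ) :=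
  {x | ∃ (t : Finset (Fin d → ℤ)) (c : (Fin d → ℤ) → ℝ),
    (t : Set (Fin d → ℤ)) ⊆ S ∧ (∀ v, 0 ≤ c v) ∧ x = ∑ v ∈ t, c v • toR v}

/-- `ℕS`, the submonoid of `ℤ^d` generated by `S`. -/
def NSemi {d : ℕ} (S : Set (Fin d → ℤ)) : AddSubmonoid (Fin d → ℤ) :=
  AddSubmonoid.closure S

/-- `ℤS`, the subgroup of `ℤ^d` generated by `S`. -/
def ZGrp {d : ℕ} (S : Set (Fin d → ℤ)) : AddSubgroup (Fin d → ℤ) :=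
  AddSubgroup.closure S

/-- `ℝS`, the real linear span of `S`. -/
def RSpan {d : ℕ} (S : Set (Fin d → ℤ)) : Submodule ℝ (Fin d → ℝ) :=
  Submodule.span ℝ (toR '' S)

/-- `A` is a configuration: a finite set of nonzero lattice points whose `ℤ`-span is `ℤ^d`
and whose nonnegative real cone is strongly convex (contains no line, i.e. is pointed). -/
structure IsConfig {d : ℕ} (A : Set (Fin d → ℤ)) : Prop where
  (finite : A.Finite)
  (nonzero : (0 : Fin d → ℤ) ∉ A)
  (spans : ZGrp A = ⊤)
  (pointed : ∀ x ∈ cone A, -x ∈ cone A → x = 0)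

/-- `F` is a face of the configuration `A`: `F ⊆ A`, the cone over `F` is an extreme
subset (face) of the cone over `A`, and `ℝ_{≥0}F ∩ A = F`. -/
def IsFace {d : ℕ} (A F : Set (Fin d → ℤ)) : Prop :=
  F ⊆ A ∧ IsExtreme ℝ (cone A) (cone F) ∧ cone F ∩ (toR '' A) = toR '' F

/-- The set `a + ℕF`. -/
def cell {d : ℕ} (a : Fin d → ℤ) (F : Set (Fin d → ℤ)) : Set (Fin d → ℤ) :=
  {x | ∃ f ∈ NSemi F, x = a + f}

/-- Two pairs `(a,F)` and `(b,F)` belonging to the same face `F` overlap: `a - b ∈ ℤF`. -/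
def Overlap {d : ℕ} (F : Set (Fin d → ℤ)) (a b : Fin d → ℤ) : Prop :=
  a - b ∈ ZGrp F

/-- The pair `(a,F)` divides the pair `(b,G)`:
there is `c ∈ ℕA` with `a + c + ℕF ⊆ b + ℕG`. -/
def PairDvd {d : ℕ} (A : Set (Fin d → ℤ)) (a : Fin d → ℤ) (F : Set (Fin d → ℤ))
    (b : Fin d → ℤ) (G : Set (Fin d → ℤ)) : Prop :=
  ∃ c ∈ NSemi A, cell (a + c) F ⊆ cell b G

/-- `E` is the exponent set of a monomial ideal of `ℕA`: `E ⊆ ℕA` and `E + ℕA ⊆ E`. -/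
def IsExpSet {d : ℕ} (A E : Set (Fin d → ℤ)) : Prop :=
  E ⊆ (NSemi A : Set (Fin d → ℤ)) ∧ ∀ e ∈ E, ∀ c ∈ NSemi A, e + c ∈ E

/-- The standard monomials of `E`: `ℕA ∖ E`. -/
def stdSet {d : ℕ} (A E : Set (Fin d → ℤ)) : Set (Fin d → ℤ) :=
  (NSemi A : Set (Fin d → ℤ)) \ E

/-- `(a,F)` is a proper pair of `E`: a pair of `A` with `a + ℕF ⊆ std(E)`. -/
def ProperPair {d : ℕ} (A E : Set (Fin d → ℤ)) (a : Fin d → ℤ)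
    (F : Set (Fin d → ℤ)) : Prop :=
  a ∈ NSemi A ∧ IsFace A F ∧ cell a F ⊆ stdSet A E

/-- `(a,F)` is a standard pair of `E`: a proper pair of `E` maximal with respect to
the partial order `(a,F) ≼ (b,G) ↔ a + ℕF ⊆ b + ℕG`. -/
def StdPair {d : ℕ} (A E : Set (Fin d → ℤ)) (a : Fin d → ℤ)
    (F : Set (Fin d → ℤ)) : Prop :=
  ProperPair A E a F ∧
    ∀ b G, ProperPair A E b G → cell a F ⊆ cell b G → cell b G ⊆ cell a F

/-- The overlap class of the standard pair `(a,F)` of `E` is maximal with respect to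
divisibility among overlap classes of standard pairs of `E`. -/
def MaxClass {d : ℕ} (A E : Set (Fin d → ℤ)) (a : Fin d → ℤ)
    (F : Set (Fin d → ℤ)) : Prop :=
  ∀ b G, StdPair A E b G → PairDvd A a F b G → PairDvd A b G a F

noncomputable section

/-- The affine semigroup ring `k[ℕA]`. -/
abbrev SGRing {d : ℕ} (k : Type*) [Field k] (A : Set (Fin d → ℤ)) :=
  AddMonoidAlgebra k (NSemi A)

/-- The monomial `t^a` of `k[ℕA]`. -/
def mono {d : ℕ} (k : Type*) [Field k] (A : Set (Fin d → ℤ)) (a : (NSemi A)) :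
    SGRing k A :=
  AddMonoidAlgebra.single a 1

/-- `I` is a monomial ideal of `k[ℕA]`: an ideal generated by monomials. -/
def IsMonomialIdeal {d : ℕ} (k : Type*) [Field k] (A : Set (Fin d → ℤ))
    (I : Ideal (SGRing k A)) : Prop :=
  ∃ S : Set (NSemi A), I = Ideal.span ((fun a => mono k A a) '' S)

/-- The exponent set `E(I) = {a ∈ ℕA : t^a ∈ I}` of an ideal of `k[ℕA]`,
as a subset of `ℤ^d`. -/
def expSet {d : ℕ} (k : Type*) [Field k] (A : Set (Fin d → ℤ))
    (I : Ideal (SGRing k A)) : Set (Fin d → ℤ) :=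
  {x | ∃ h : x ∈ NSemi A, mono k A ⟨x, h⟩ ∈ I}

/-- The monomial prime ideal `p_F = ⟨t^a : a ∈ ℕA ∖ ℕF⟩` of `k[ℕA]`. -/
def primeF {d : ℕ} (k : Type*) [Field k] (A F : Set (Fin d → ℤ)) :
    Ideal (SGRing k A) :=
  Ideal.span {x | ∃ a : (NSemi A), (a : Fin d → ℤ) ∉ NSemi F ∧ x = mono k A a}

end

section Cone

variable {d : ℕ}

lemma toR_injective : Function.Injective (toR (d := d)) := by
  intro v w h
  funext i
  have := congrFun h i
  simpa [toR] using this

lemma toR_add (v w : Fin d → ℤ) : toR (v + w) = toR v + toR w := by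
  funext i
  simp [toR]

lemma zero_mem_cone (S : Set (Fin d → ℤ)) : (0 : Fin d → ℝ) ∈ cone S :=
  ⟨∅, 0, by simp, by simp, by simp⟩

lemma toR_mem_cone {S : Set (Fin d → ℤ)} {v : Fin d → ℤ} (hv : v ∈ S) : toR v ∈ cone S :=
  ⟨{v}, fun _ => 1, by simpa using hv, by simp, by simp⟩

lemma add_mem_cone {S : Set (Fin d → ℤ)} {x y : Fin d → ℝ} (hx : x ∈ cone S)
    (hy : y ∈ cone S) : x + y ∈ cone S := by
  classical
  obtain ⟨t, c, ht, hc, rfl⟩ := hx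
  obtain ⟨t', c', ht', hc', rfl⟩ := hy
  refine ⟨t ∪ t', fun v => (if v ∈ t then c v else 0) + (if v ∈ t' then c' v else 0),
    by simp [ht, ht'], fun v => ?_, ?_⟩
  · have := hc v
    have := hc' v
    positivity
  · simp only [add_smul, Finset.sum_add_distrib, ite_smul, zero_smul, Finset.sum_ite_mem,
      Finset.inter_eq_right.2 Finset.subset_union_left,
      Finset.inter_eq_right.2 Finset.subset_union_right]

lemma smul_mem_cone {S : Set (Fin d → ℤ)} {x : Fin d → ℝ} {r : ℝ} (hr : 0 ≤ r)
    (hx : x ∈ cone S) : r • x ∈ cone S := by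
  obtain ⟨t, c, ht, hc, rfl⟩ := hx
  exact ⟨t, fun v => r * c v, ht, fun v => mul_nonneg hr (hc v), by
    simp [Finset.smul_sum, mul_smul]⟩

lemma toR_mem_cone_of_mem_NSemi {S : Set (Fin d → ℤ)} {v : Fin d → ℤ} (hv : v ∈ NSemi S) :
    toR v ∈ cone S := by
  induction hv using AddSubmonoid.closure_induction with
  | mem x hx => exact toR_mem_cone hx
  | zero => convert zero_mem_cone S using 1; funext i; simp [toR]
  | add x y _ _ hx hy => rw [toR_add]; exact add_mem_cone hx hy

end Cone

section Face

variable {d : ℕ} {A F : Set (Fin d → ℤ)}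

lemma IsFace.NSemi_le (hF : IsFace A F) : NSemi F ≤ NSemi A :=
  AddSubmonoid.closure_mono hF.1

lemma IsFace.mem_of_toR_mem_cone (hF : IsFace A F) {v : Fin d → ℤ} (hv : v ∈ A)
    (hc : toR v ∈ cone F) : v ∈ F := by
  have : toR v ∈ toR '' F := hF.2.2 ▸ ⟨hc, v, hv, rfl⟩
  exact (toR_injective.mem_set_image).1 this

lemma IsFace.left_mem_cone_of_add (hF : IsFace A F) {x y : Fin d → ℝ} (hx : x ∈ cone A)
    (hy : y ∈ cone A) (hxy : x + y ∈ cone F) : x ∈ cone F := by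
  refine hF.2.1.left_mem_of_mem_openSegment hx hy (smul_mem_cone (r := 1 / 2) (by norm_num) hxy)
    ⟨1 / 2, 1 / 2, by norm_num, by norm_num, by norm_num, by rw [smul_add]⟩

lemma IsFace.mem_NSemi_of_toR_mem_cone (hF : IsFace A F) {v : Fin d → ℤ} (hv : v ∈ NSemi A)
    (hc : toR v ∈ cone F) : v ∈ NSemi F := by
  induction hv using AddSubmonoid.closure_induction with
  | mem x hx => exact AddSubmonoid.subset_closure (hF.mem_of_toR_mem_cone hx hc)
  | zero => exact zero_mem _
  | add x y hx hy ihx ihy =>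
    rw [toR_add] at hc
    have hx' := toR_mem_cone_of_mem_NSemi hx
    have hy' := toR_mem_cone_of_mem_NSemi hy
    exact add_mem (ihx (hF.left_mem_cone_of_add hx' hy' hc))
      (ihy (hF.left_mem_cone_of_add hy' hx' (by rwa [add_comm])))

lemma IsFace.left_mem_NSemi_of_add (hF : IsFace A F) {x y : Fin d → ℤ} (hx : x ∈ NSemi A)
    (hy : y ∈ NSemi A) (hxy : x + y ∈ NSemi F) : x ∈ NSemi F :=
  hF.mem_NSemi_of_toR_mem_cone hx <| hF.left_mem_cone_of_add (toR_mem_cone_of_mem_NSemi hx)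
    (toR_mem_cone_of_mem_NSemi hy) (toR_add x y ▸ toR_mem_cone_of_mem_NSemi hxy)

lemma IsFace.subset_of_NSemi_le {G : Set (Fin d → ℤ)} (hF : IsFace A F) (hG : IsFace A G)
    (h : NSemi G ≤ NSemi F) : G ⊆ F := fun _ hg =>
  hF.mem_of_toR_mem_cone (hG.1 hg)
    (toR_mem_cone_of_mem_NSemi (h (AddSubmonoid.subset_closure hg)))

lemma sub_mem_ZGrp {x y : Fin d → ℤ} (hx : x ∈ NSemi F) (hy : y ∈ NSemi F) :
    x - y ∈ ZGrp F :=
  sub_mem (AddSubgroup.le_closure_toAddSubmonoid F hx) (AddSubgroup.le_closure_toAddSubmonoid F hy)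

lemma exists_sub_of_mem_ZGrp {z : Fin d → ℤ} (hz : z ∈ ZGrp F) :
    ∃ x ∈ NSemi F, ∃ y ∈ NSemi F, z = x - y := by
  induction hz using AddSubgroup.closure_induction with
  | mem x hx => exact ⟨x, AddSubmonoid.subset_closure hx, 0, zero_mem _, by simp⟩
  | zero => exact ⟨0, zero_mem _, 0, zero_mem _, by simp⟩
  | add x y _ _ hx hy =>
    obtain ⟨a, ha, b, hb, rfl⟩ := hx
    obtain ⟨a', ha', b', hb', rfl⟩ := hy
    exact ⟨a + a', add_mem ha ha', b + b', add_mem hb hb', by abel⟩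
  | neg x _ hx =>
    obtain ⟨a, ha, b, hb, rfl⟩ := hx
    exact ⟨b, hb, a, ha, by abel⟩

end Face

section Cell

variable {d : ℕ} {F G : Set (Fin d → ℤ)} {a b : Fin d → ℤ}

lemma self_mem_cell (a : Fin d → ℤ) (F : Set (Fin d → ℤ)) : a ∈ cell a F :=
  ⟨0, zero_mem _, by simp⟩

lemma cell_subset_cell_iff : cell a F ⊆ cell b F ↔ a ∈ cell b F := by
  refine ⟨fun h => h (self_mem_cell a F), ?_⟩
  rintro ⟨f, hf, rfl⟩ _ ⟨g, hg, rfl⟩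
  exact ⟨f + g, add_mem hf hg, by abel⟩

end Cell

/-- `(a,F)` divides `(b,F)`, phrased through a common multiple: `b - a ∈ ℕA - ℕF`. -/
def FaceDvd {d : ℕ} (A F : Set (Fin d → ℤ)) (a b : Fin d → ℤ) : Prop :=
  ∃ c ∈ NSemi A, ∃ f ∈ NSemi F, a + c = b + f

section FaceDvd

variable {d : ℕ} {A F : Set (Fin d → ℤ)} {a b c : Fin d → ℤ}

lemma pairDvd_iff_faceDvd : PairDvd A a F b F ↔ FaceDvd A F a b := by
  simp only [PairDvd, FaceDvd, cell_subset_cell_iff]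
  rfl

lemma FaceDvd.trans (hab : FaceDvd A F a b) (hbc : FaceDvd A F b c) : FaceDvd A F a c := by
  obtain ⟨q, hq, f, hf, h⟩ := hab
  obtain ⟨q', hq', f', hf', h'⟩ := hbc
  refine ⟨q + q', add_mem hq hq', f' + f, add_mem hf' hf, ?_⟩
  linear_combination h + h'

lemma faceDvd_refl (a : Fin d → ℤ) : FaceDvd A F a a :=
  ⟨0, zero_mem _, 0, zero_mem _, rfl⟩

lemma IsFace.mem_of_faceDvd_add (hF : IsFace A F) {q f : Fin d → ℤ} (hq : q ∈ NSemi A)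
    (hf : f ∈ NSemi F) (h : a + q = b + f) (hba : FaceDvd A F b a) : q ∈ NSemi F := by
  obtain ⟨q', hq', f', hf', h'⟩ := hba
  refine hF.left_mem_NSemi_of_add hq hq' ?_
  have : q + q' = f + f' := by linear_combination h + h'
  exact this ▸ add_mem hf hf'

lemma IsFace.overlap_of_faceDvd (hF : IsFace A F) (hab : FaceDvd A F a b)
    (hba : FaceDvd A F b a) : Overlap F a b := by
  obtain ⟨q, hq, f, hf, h⟩ := hab
  have hq' := hF.mem_of_faceDvd_add hq hf h hba
  have : a - b = f - q := by linear_combination h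
  exact (this ▸ sub_mem_ZGrp hf hq' : a - b ∈ ZGrp F)

lemma IsFace.faceDvd_of_overlap (hF : IsFace A F) (h : Overlap F a b) : FaceDvd A F a b := by
  obtain ⟨x, hx, y, hy, h⟩ := exists_sub_of_mem_ZGrp h
  exact ⟨y, hF.NSemi_le hy, x, hx, by linear_combination h⟩

lemma IsFace.faceDvd_of_mem_cell (hF : IsFace A F) (h : a ∈ cell b F) :
    FaceDvd A F a b ∧ FaceDvd A F b a := by
  obtain ⟨f, hf, rfl⟩ := h
  exact ⟨⟨0, zero_mem _, f, hf, by simp⟩, ⟨f, hF.NSemi_le hf, 0, zero_mem _, by simp⟩⟩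

end FaceDvd

section Monomial

variable {d : ℕ} {k : Type*} [Field k] {A : Set (Fin d → ℤ)}

lemma mem_span_mono_image {S : Set (NSemi A)} {g : SGRing k A} :
    g ∈ Ideal.span ((fun a => mono k A a) '' S) ↔
      ∀ m ∈ g.coeff.support, ∃ m' ∈ S, ∃ c, m = c + m' :=
  AddMonoidAlgebra.mem_ideal_span_of'_image

lemma support_mono (a : NSemi A) : (mono k A a).coeff.support = {a} := by
  simp [mono]

lemma mono_mul_mono (a b : NSemi A) : mono k A a * mono k A b = mono k A (a + b) := by
  simp [mono]

lemma mono_pow (a : NSemi A) (n : ℕ) : mono k A a ^ n = mono k A (n • a) := by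
  simp [mono, AddMonoidAlgebra.single_pow]

lemma mem_span_mono_image_of_upward {S : Set (NSemi A)} (hS : ∀ s ∈ S, ∀ c, c + s ∈ S)
    {g : SGRing k A} :
    g ∈ Ideal.span ((fun a => mono k A a) '' S) ↔ ∀ m ∈ g.coeff.support, m ∈ S := by
  rw [mem_span_mono_image]
  refine forall₂_congr fun m _ => ⟨?_, fun h => ⟨m, h, 0, by simp⟩⟩
  rintro ⟨m', hm', c, rfl⟩
  exact hS _ hm' _

lemma mono_mem_span_iff {S : Set (NSemi A)} (hS : ∀ s ∈ S, ∀ c, c + s ∈ S) {a : NSemi A} :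
    mono k A a ∈ Ideal.span ((fun a => mono k A a) '' S) ↔ a ∈ S := by
  simp [mem_span_mono_image_of_upward hS, support_mono]

lemma IsMonomialIdeal.mem_iff {I : Ideal (SGRing k A)} (hI : IsMonomialIdeal k A I)
    {g : SGRing k A} : g ∈ I ↔ ∀ m ∈ g.coeff.support, mono k A m ∈ I := by
  obtain ⟨S, rfl⟩ := hI
  simp only [mem_span_mono_image, support_mono, Finset.mem_singleton, forall_eq]

instance isDomain_SGRing : IsDomain (SGRing k A) := by
  have : UniqueSums (NSemi A) :=
    UniqueSums.of_injective_addHom (NSemi A).subtype.toAddHom Subtype.val_injective inferInstance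
  infer_instance

lemma isNoetherianRing_SGRing (k : Type*) [Field k] (hA : A.Finite) :
    IsNoetherianRing (SGRing k A) := by
  have : AddMonoid.FG (NSemi A) :=
    (AddMonoid.fg_iff_addSubmonoid_fg _).2 ⟨hA.toFinset, by simp [NSemi]⟩
  exact Algebra.FiniteType.isNoetherianRing k _

/-- Ascending chain condition for upward closed subsets of `ℕA`. -/
lemma exists_maximal_upward (hA : A.Finite) {ι : Type*} {T : Set ι}
    (hT : T.Nonempty) (U : ι → Set (NSemi A)) (hU : ∀ i, ∀ s ∈ U i, ∀ c, c + s ∈ U i) :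
    ∃ i ∈ T, ∀ j ∈ T, U i ⊆ U j → U j ⊆ U i := by
  have := isNoetherianRing_SGRing ℚ hA
  obtain ⟨_, ⟨i, hi, rfl⟩, hmax⟩ := set_has_maximal_iff_noetherian.2 this
    ((fun i => Ideal.span ((fun a => mono ℚ A a) '' U i)) '' T) (hT.image _)
  refine ⟨i, hi, fun j hj hij s hs => ?_⟩
  by_contra hsi
  refine hmax _ ⟨j, hj, rfl⟩ (lt_of_le_of_ne (Ideal.span_mono (Set.image_mono hij)) fun heq => ?_)
  refine hsi ((mono_mem_span_iff (k := ℚ) (hU i)).1 ?_)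
  exact heq.symm.le ((mono_mem_span_iff (hU j)).2 hs)

end Monomial

/-- The properties of the exponent set of a `p_F`-primary monomial ideal. -/
structure IsPrimaryExpSet {d : ℕ} (A F E : Set (Fin d → ℤ)) : Prop where
  (upward : ∀ x ∈ E, ∀ c ∈ NSemi A, x + c ∈ E)
  (mem_of_add : ∀ x ∈ NSemi A, ∀ f ∈ NSemi F, x + f ∈ E → x ∈ E)
  (nilpotent : ∀ c ∈ NSemi A, c ∉ NSemi F → ∃ n : ℕ, n • c ∈ E)

section PrimaryExpSet

variable {d : ℕ} {A F E : Set (Fin d → ℤ)}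

lemma IsPrimaryExpSet.NSemi_le_of_properPair (hE : IsPrimaryExpSet A F E)
    {a : Fin d → ℤ} {G : Set (Fin d → ℤ)} (h : ProperPair A E a G) : NSemi G ≤ NSemi F := by
  refine AddSubmonoid.closure_le.2 fun g hg => ?_
  by_contra hgF
  have hg' : g ∈ NSemi G := AddSubmonoid.subset_closure hg
  obtain ⟨n, hn⟩ := hE.nilpotent g (h.2.1.NSemi_le hg') hgF
  refine (h.2.2 ⟨n • g, nsmul_mem hg' n, rfl⟩ : a + n • g ∈ stdSet A E).2 ?_
  rw [add_comm]
  exact hE.upward _ hn _ h.1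

lemma IsPrimaryExpSet.properPair (hE : IsPrimaryExpSet A F E) (hF : IsFace A F)
    {a : Fin d → ℤ} (ha : a ∈ stdSet A E) : ProperPair A E a F := by
  refine ⟨ha.1, hF, ?_⟩
  rintro _ ⟨f, hf, rfl⟩
  exact ⟨add_mem ha.1 (hF.NSemi_le hf), fun h => ha.2 (hE.mem_of_add a ha.1 f hf h)⟩

lemma StdPair.mem_stdSet {a : Fin d → ℤ} {G : Set (Fin d → ℤ)} (h : StdPair A E a G) :
    a ∈ stdSet A E :=
  h.1.2.2 (self_mem_cell a G)

lemma IsPrimaryExpSet.face_eq_of_stdPair (hE : IsPrimaryExpSet A F E) (hF : IsFace A F)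
    {a : Fin d → ℤ} {G : Set (Fin d → ℤ)} (h : StdPair A E a G) : G = F := by
  have hGF := hE.NSemi_le_of_properPair h.1
  refine (hF.subset_of_NSemi_le h.1.2.1 hGF).antisymm (h.1.2.1.subset_of_NSemi_le hF ?_)
  intro f hf
  have hle : cell a G ⊆ cell a F := by
    rintro _ ⟨g, hg, rfl⟩
    exact ⟨g, hGF hg, rfl⟩
  obtain ⟨g, hg, h'⟩ := h.2 a F (hE.properPair hF h.mem_stdSet) hle ⟨f, hf, rfl⟩
  exact add_left_cancel h' ▸ hg

lemma IsPrimaryExpSet.exists_stdPair (hE : IsPrimaryExpSet A F E) (hA : A.Finite)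
    (hF : IsFace A F) {x : Fin d → ℤ} (hx : x ∈ stdSet A E) :
    ∃ b, StdPair A E b F ∧ x ∈ cell b F := by
  obtain ⟨b, ⟨hb, hxb⟩, hmax⟩ := exists_maximal_upward hA
    (T := {b | b ∈ NSemi A ∧ x ∈ cell b F}) ⟨x, hx.1, self_mem_cell x F⟩
    (fun b => {s | ∃ q ∈ NSemi A, (s : Fin d → ℤ) = b + q}) (by
      rintro b s ⟨q, hq, h⟩ c
      exact ⟨c + q, add_mem c.2 hq, by rw [AddSubmonoid.coe_add, h]; abel⟩)
  have hbs : b ∈ stdSet A E := by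
    refine ⟨hb, fun h => hx.2 ?_⟩
    obtain ⟨f, hf, rfl⟩ := hxb
    exact hE.upward b h f (hF.NSemi_le hf)
  refine ⟨b, ⟨hE.properPair hF hbs, fun b' G hG hle => ?_⟩, hxb⟩
  have hGF := hE.NSemi_le_of_properPair hG
  obtain ⟨g, hg, hbg⟩ := hle (self_mem_cell b F)
  have hxb' : x ∈ cell b' F := by
    obtain ⟨f, hf, rfl⟩ := hxb
    exact ⟨g + f, add_mem (hGF hg) hf, by rw [hbg]; abel⟩
  obtain ⟨q, hq, hq'⟩ := hmax b' ⟨hG.1, hxb'⟩ (by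
    rintro s ⟨q, hq, h⟩
    exact ⟨g + q, add_mem (hG.2.1.NSemi_le hg) hq, by rw [h, hbg]; abel⟩)
    (show (⟨b', hG.1⟩ : NSemi A) ∈ _ from ⟨0, zero_mem _, by simp⟩)
  replace hq' : b' = b + q := hq'
  have hqF : q ∈ NSemi F := by
    refine hF.left_mem_NSemi_of_add hq (hG.2.1.NSemi_le hg) ?_
    have : q + g = 0 := by linear_combination -hq' - hbg
    rw [this]
    exact zero_mem _
  rintro _ ⟨g', hg', rfl⟩
  exact ⟨q + g', add_mem hqF (hGF hg'), by rw [hq']; abel⟩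

lemma IsPrimaryExpSet.exists_maximal (hE : IsPrimaryExpSet A F E) (hA : A.Finite)
    (hF : IsFace A F) {x : Fin d → ℤ} (hx : x ∈ stdSet A E) :
    ∃ b ∈ stdSet A E, FaceDvd A F x b ∧
      ∀ y ∈ stdSet A E, FaceDvd A F b y → FaceDvd A F y b := by
  obtain ⟨b, ⟨hb, hxb⟩, hmax⟩ := exists_maximal_upward hA
    (T := {b | b ∈ stdSet A E ∧ FaceDvd A F x b}) ⟨x, hx, faceDvd_refl x⟩
    (fun b => {s : NSemi A | b + s ∈ E}) (by
      intro b s h c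
      have : b + ((c + s : NSemi A) : Fin d → ℤ) = (b + s) + c := by
        rw [AddSubmonoid.coe_add]; abel
      exact (this ▸ hE.upward _ h c c.2 : _ ∈ E))
  refine ⟨b, hb, hxb, fun y hy hby => ?_⟩
  obtain ⟨q, hq, f, hf, h⟩ := hby
  have hcolon := hmax y ⟨hy, hxb.trans ⟨q, hq, f, hf, h⟩⟩ (by
    intro s hs
    refine hE.mem_of_add _ (add_mem hy.1 s.2) f hf ?_
    have : y + (s : Fin d → ℤ) + f = (b + s) + q := by linear_combination -h
    exact this ▸ hE.upward _ hs q hq)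
  have hqF : q ∈ NSemi F := by
    by_contra hqF
    have hstd : ∀ n : ℕ, b + n • q ∉ E := by
      intro n
      induction n with
      | zero => simpa using hb.2
      | succ n ih =>
        refine fun hn => ih (hcolon (show (⟨n • q, nsmul_mem hq n⟩ : NSemi A) ∈ _ from ?_))
        refine hE.mem_of_add _ (add_mem hy.1 (nsmul_mem hq n)) f hf ?_
        have : y + n • q + f = b + (n + 1) • q := by
          rw [succ_nsmul]; linear_combination -h
        exact this ▸ hn
    obtain ⟨n, hn⟩ := hE.nilpotent q hq hqF
    exact hstd n (add_comm (n • q) b ▸ hE.upward _ hn b hb.1)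
  exact ⟨f, hF.NSemi_le hf, q, hqF, h.symm⟩

lemma IsPrimaryExpSet.single_maxClass_iff (hE : IsPrimaryExpSet A F E) (hA : A.Finite)
    (hF : IsFace A F) :
    ((∃ a G, StdPair A E a G ∧ MaxClass A E a G) ∧
        ∀ a G b G', StdPair A E a G → MaxClass A E a G →
          StdPair A E b G' → MaxClass A E b G' → G = G' ∧ Overlap G a b) ↔
      ∃ a ∈ stdSet A E, ∀ x ∈ stdSet A E, FaceDvd A F x a := by
  constructor
  · rintro ⟨⟨a, G, ha, hamax⟩, huniq⟩
    obtain rfl := hE.face_eq_of_stdPair hF ha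
    refine ⟨a, ha.mem_stdSet, fun x hx => ?_⟩
    obtain ⟨b, hb, hxb, hbmax⟩ := hE.exists_maximal hA hF hx
    obtain ⟨b', hb', hbb'⟩ := hE.exists_stdPair hA hF hb
    obtain ⟨h₁, h₂⟩ := hF.faceDvd_of_mem_cell hbb'
    have hb'max : MaxClass A E b' G := by
      intro c H hc hdvd
      obtain rfl := hE.face_eq_of_stdPair hF hc
      rw [pairDvd_iff_faceDvd] at hdvd ⊢
      exact (hbmax c hc.mem_stdSet (h₁.trans hdvd)).trans h₁
    exact (hxb.trans h₁).trans
      (hF.faceDvd_of_overlap (huniq b' G a G hb' hb'max ha hamax).2)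
  · rintro ⟨a, ha, htop⟩
    obtain ⟨b, hb, hab⟩ := hE.exists_stdPair hA hF ha
    have htop' : ∀ c G, StdPair A E c G → FaceDvd A F c b := fun c G hc =>
      (htop c hc.mem_stdSet).trans (hF.faceDvd_of_mem_cell hab).1
    refine ⟨⟨b, F, hb, fun c G hc _ => ?_⟩, fun c G c' G' hc hcmax hc' hcmax' => ?_⟩
    · obtain rfl := hE.face_eq_of_stdPair hF hc
      exact pairDvd_iff_faceDvd.2 (htop' c G hc)
    · obtain rfl := hE.face_eq_of_stdPair hF hc
      obtain rfl := hE.face_eq_of_stdPair hF hc'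
      have h₁ := pairDvd_iff_faceDvd.1 (hcmax b _ hb (pairDvd_iff_faceDvd.2 (htop' c _ hc)))
      have h₂ := pairDvd_iff_faceDvd.1 (hcmax' b _ hb (pairDvd_iff_faceDvd.2 (htop' c' _ hc')))
      exact ⟨rfl, hF.overlap_of_faceDvd ((htop' c _ hc).trans h₂) ((htop' c' _ hc').trans h₁)⟩

end PrimaryExpSet

section Ring

variable {d : ℕ} {k : Type*} [Field k] {A F : Set (Fin d → ℤ)} {I : Ideal (SGRing k A)}

lemma coe_mem_expSet_iff {m : NSemi A} : (m : Fin d → ℤ) ∈ expSet k A I ↔ mono k A m ∈ I :=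
  ⟨fun ⟨_, h⟩ => h, fun h => ⟨m.2, h⟩⟩

lemma coe_mem_stdSet_iff {m : NSemi A} :
    (m : Fin d → ℤ) ∈ stdSet A (expSet k A I) ↔ mono k A m ∉ I :=
  ⟨fun h hm => h.2 (coe_mem_expSet_iff.2 hm),
    fun h => ⟨m.2, fun hm => h (coe_mem_expSet_iff.1 hm)⟩⟩

lemma IsFace.mono_mem_primeF_iff (hF : IsFace A F) {a : NSemi A} :
    mono k A a ∈ primeF k A F ↔ (a : Fin d → ℤ) ∉ NSemi F := by
  have : {x | ∃ a : NSemi A, (a : Fin d → ℤ) ∉ NSemi F ∧ x = mono k A a} =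
      (fun a => mono k A a) '' {a : NSemi A | (a : Fin d → ℤ) ∉ NSemi F} := by
    ext x
    simp only [Set.mem_ofPred_eq, Set.mem_image, eq_comm]
  rw [primeF, this, mono_mem_span_iff]
  · rfl
  · exact fun s hs c h => hs (hF.left_mem_NSemi_of_add s.2 c.2 (by
      rwa [AddSubmonoid.coe_add, add_comm] at h))

lemma isPrimaryExpSet_expSet (hF : IsFace A F) (hprimary : I.IsPrimary)
    (hrad : I.radical = primeF k A F) : IsPrimaryExpSet A F (expSet k A I) where
  upward := by
    rintro x ⟨hx, h⟩ c hc
    refine ⟨add_mem hx hc, ?_⟩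
    exact mono_mul_mono (k := k) ⟨x, hx⟩ ⟨c, hc⟩ ▸ I.mul_mem_right _ h
  mem_of_add := by
    rintro x hx f hf ⟨hxf, h⟩
    refine ⟨hx, ?_⟩
    have hmul : mono k A ⟨x, hx⟩ * mono k A ⟨f, hF.NSemi_le hf⟩ ∈ I := by
      rw [mono_mul_mono]
      exact h
    refine ((Ideal.isPrimary_iff.1 hprimary).2 hmul).resolve_right ?_
    rw [hrad, hF.mono_mem_primeF_iff]
    exact not_not.2 hf
  nilpotent := by
    intro c hc hcF
    have : mono k A ⟨c, hc⟩ ∈ I.radical := by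
      rw [hrad, hF.mono_mem_primeF_iff]
      exact hcF
    obtain ⟨n, hn⟩ := this
    rw [mono_pow] at hn
    exact ⟨n, (n • (⟨c, hc⟩ : NSemi A)).2, hn⟩

/-- Discarding the terms of `g` that lie in the monomial ideal `I`. -/
lemma IsMonomialIdeal.exists_standard_part (hI : IsMonomialIdeal k A I) (g : SGRing k A) :
    ∃ g' : SGRing k A, g - g' ∈ I ∧
      ∀ m, m ∈ g'.coeff.support ↔ m ∈ g.coeff.support ∧ mono k A m ∉ I := by
  classical
  refine ⟨.ofCoeff (g.coeff.filter fun m => mono k A m ∉ I), hI.mem_iff.2 fun m hm => ?_,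
    fun m => ?_⟩
  · by_contra h
    simp [h] at hm
  · simp [and_comm]

lemma mem_support_mono_mul_iff {a m : NSemi A} {g : SGRing k A} :
    m ∈ (mono k A a * g).coeff.support ↔ ∃ y ∈ g.coeff.support, m = a + y := by
  rw [mono, AddMonoidAlgebra.support_coeff_single_mul _ _ (by simp)]
  simp [eq_comm]

lemma exists_eq_mono_mul {a : NSemi A} {S : Set (NSemi A)} {g : SGRing k A}
    (hg : ∀ m ∈ g.coeff.support, ∃ s ∈ S, m = a + s) :
    ∃ u : SGRing k A, (∀ s ∈ u.coeff.support, s ∈ S) ∧ g = mono k A a * u := by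
  have hinj : Function.Injective (a + ·) := add_right_injective a
  refine ⟨.ofCoeff (g.coeff.comapDomain (a + ·) hinj.injOn), fun s hs => ?_, ?_⟩
  · obtain ⟨s', hs', h⟩ := hg (a + s) (by simpa using hs)
    exact add_left_cancel h ▸ hs'
  · ext m
    by_cases h : ∃ s, m = a + s
    · obtain ⟨s, rfl⟩ := h
      simp [mono, AddMonoidAlgebra.coeff_single_mul_add]
    · rw [mono, AddMonoidAlgebra.coeff_single_mul_of_forall_add_ne _ _ fun s hs => h ⟨s, hs.symm⟩]
      by_contra hm
      obtain ⟨s, -, hs⟩ := hg m (by simpa using hm)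
      exact h ⟨s, hs⟩

lemma exists_minimal_faceDvd (F : Set (Fin d → ℤ)) {s : Finset (NSemi A)} (hs : s.Nonempty) :
    ∃ x ∈ s, ∀ y ∈ s, FaceDvd A F y x → FaceDvd A F x y := by
  let r : s → s → Prop := fun y x => FaceDvd A F y.1 x.1 ∧ ¬ FaceDvd A F x.1 y.1
  have : IsTrans s r := ⟨fun a b c hab hbc =>
    ⟨hab.1.trans hbc.1, fun hca => hab.2 (hbc.1.trans hca)⟩⟩
  have : Std.Irrefl r := ⟨fun a h => h.2 h.1⟩
  obtain ⟨x, -, hx⟩ := (Finite.wellFounded_of_trans_of_irrefl r).has_min Set.univ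
    ⟨⟨hs.choose, hs.choose_spec⟩, trivial⟩
  exact ⟨x, x.2, fun y hy hyx => not_not.1 fun h => hx ⟨y, hy⟩ trivial ⟨hyx, h⟩⟩

lemma exists_common_shift {a : Fin d → ℤ} (s : Finset (NSemi A))
    (hs : ∀ m ∈ s, ∃ f ∈ NSemi F, (m : Fin d → ℤ) + f ∈ cell a F) :
    ∃ f ∈ NSemi F, ∀ m ∈ s, (m : Fin d → ℤ) + f ∈ cell a F := by
  classical
  induction s using Finset.induction_on with
  | empty => exact ⟨0, zero_mem _, by simp⟩
  | insert x s _ ih =>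
    obtain ⟨f, hf, h⟩ := ih fun m hm => hs m (Finset.mem_insert_of_mem hm)
    obtain ⟨f', hf', e, he, h'⟩ := hs x (Finset.mem_insert_self x s)
    refine ⟨f + f', add_mem hf hf', fun m hm => ?_⟩
    obtain rfl | hm := Finset.mem_insert.1 hm
    · exact ⟨e + f, add_mem he hf, by linear_combination h'⟩
    · obtain ⟨e', he', hshift⟩ := h m hm
      exact ⟨e' + f', add_mem he' hf', by linear_combination hshift⟩

/-- If every standard monomial divides the class of `a`, then every ideal strictly containing `I`
contains a nonzero element of `t^a k[ℕF]`. -/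
lemma exists_mono_mul_mem_of_lt (hI : IsMonomialIdeal k A I) (hF : IsFace A F)
    (hE : IsPrimaryExpSet A F (expSet k A I)) {a : NSemi A}
    (ha : (a : Fin d → ℤ) ∈ stdSet A (expSet k A I))
    (htop : ∀ x ∈ stdSet A (expSet k A I), FaceDvd A F x a)
    {J : Ideal (SGRing k A)} (hIJ : I < J) :
    ∃ u : SGRing k A, u ≠ 0 ∧ (∀ s ∈ u.coeff.support, (s : Fin d → ℤ) ∈ NSemi F) ∧
      mono k A a * u ∈ J := by
  obtain ⟨g₀, hg₀J, hg₀I⟩ := Set.exists_of_ssubset hIJ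
  obtain ⟨g, hg, hgsupp⟩ := hI.exists_standard_part g₀
  have hgJ : g ∈ J := (Submodule.sub_mem_iff_right _ hg₀J).1 (hIJ.le hg)
  have hne : g.coeff.support.Nonempty := by
    rw [Finset.nonempty_iff_ne_empty]
    intro h
    have h0 : g = 0 := by ext m; simp [Finsupp.support_eq_empty.1 h]
    exact hg₀I (by simpa [h0] using hg)
  obtain ⟨x, hx, hmin⟩ := exists_minimal_faceDvd F hne
  obtain ⟨c, hc, f, hf, hxc⟩ := htop x (coe_mem_stdSet_iff.2 ((hgsupp x).1 hx).2)
  obtain ⟨h, hh, hhsupp⟩ := hI.exists_standard_part (mono k A ⟨c, hc⟩ * g)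
  have hhJ : h ∈ J := (Submodule.sub_mem_iff_right _ (J.mul_mem_left _ hgJ)).1 (hIJ.le hh)
  have hxh : (⟨c, hc⟩ : NSemi A) + x ∈ h.coeff.support := by
    rw [hhsupp, mem_support_mono_mul_iff, ← coe_mem_stdSet_iff]
    refine ⟨⟨x, hx, rfl⟩, ?_⟩
    have : (((⟨c, hc⟩ : NSemi A) + x : NSemi A) : Fin d → ℤ) = a + f := by
      rw [← hxc, AddSubmonoid.coe_add, add_comm]
    exact this ▸ (hE.properPair hF ha).2.2 ⟨f, hf, rfl⟩
  obtain ⟨e, he, hshift⟩ := exists_common_shift (F := F) (a := a) h.coeff.support (by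
    intro m hm
    obtain ⟨hm, hmI⟩ := (hhsupp m).1 hm
    obtain ⟨y, hy, rfl⟩ := mem_support_mono_mul_iff.1 hm
    obtain ⟨c', hc', f', hf', hyc⟩ := htop _ (coe_mem_stdSet_iff.2 hmI)
    rw [AddSubmonoid.coe_add] at hyc
    have hyx : (y : Fin d → ℤ) + (c' + f) = x + f' := by
      linear_combination hyc - hxc
    have hmem := hF.mem_of_faceDvd_add (add_mem hc' (hF.NSemi_le hf)) hf' hyx
      (hmin y hy ⟨_, add_mem hc' (hF.NSemi_le hf), f', hf', hyx⟩)
    exact ⟨c', hF.left_mem_NSemi_of_add hc' (hF.NSemi_le hf) hmem, f', hf', hyc⟩)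
  obtain ⟨u, hu, heq⟩ := exists_eq_mono_mul (a := a) (S := {s | (s : Fin d → ℤ) ∈ NSemi F})
    (g := mono k A ⟨e, hF.NSemi_le he⟩ * h) (by
      intro m hm
      obtain ⟨y, hy, rfl⟩ := mem_support_mono_mul_iff.1 hm
      obtain ⟨s, hs, hys⟩ := hshift y hy
      exact ⟨⟨s, hF.NSemi_le hs⟩, hs, Subtype.ext (by simpa [add_comm] using hys)⟩)
  refine ⟨u, ?_, hu, heq ▸ J.mul_mem_left _ hhJ⟩
  rintro rfl
  have := mem_support_mono_mul_iff (a := ⟨e, hF.NSemi_le he⟩).2 ⟨_, hxh, rfl⟩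
  rw [heq] at this
  simp at this

lemma irreducible_of_top (hI : IsMonomialIdeal k A I) (hF : IsFace A F)
    (hE : IsPrimaryExpSet A F (expSet k A I)) {a : Fin d → ℤ}
    (ha : a ∈ stdSet A (expSet k A I))
    (htop : ∀ x ∈ stdSet A (expSet k A I), FaceDvd A F x a)
    {J K : Ideal (SGRing k A)} (hJK : I = J ⊓ K) : I = J ∨ I = K := by
  by_contra! hne
  lift a to NSemi A using ha.1
  have hIJ : I < J := lt_of_le_of_ne (hJK.le.trans inf_le_left) hne.1
  have hIK : I < K := lt_of_le_of_ne (hJK.le.trans inf_le_right) hne.2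
  obtain ⟨u, hu0, hu, huJ⟩ := exists_mono_mul_mem_of_lt hI hF hE ha htop hIJ
  obtain ⟨v, hv0, hv, hvK⟩ := exists_mono_mul_mem_of_lt hI hF hE ha htop hIK
  have hmem : mono k A a * (u * v) ∈ I := by
    rw [hJK]
    refine ⟨mul_assoc (mono k A a) u v ▸ J.mul_mem_right _ huJ, ?_⟩
    have : mono k A a * (u * v) = u * (mono k A a * v) := by ring
    exact this ▸ K.mul_mem_left _ hvK
  have hne : (u * v).coeff.support.Nonempty := by
    rw [Finset.nonempty_iff_ne_empty]
    intro h
    refine mul_ne_zero hu0 hv0 ?_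
    ext m
    simp [Finsupp.support_eq_empty.1 h]
  obtain ⟨m, hm⟩ := hne
  have hmF : (m : Fin d → ℤ) ∈ NSemi F := by
    classical
    obtain ⟨s, hs, t, ht, rfl⟩ :=
      Finset.mem_add.1 (AddMonoidAlgebra.support_coeff_mul_subset u v hm)
    exact add_mem (hu s hs) (hv t ht)
  refine coe_mem_stdSet_iff.1 ?_
    (hI.mem_iff.1 hmem (a + m) (mem_support_mono_mul_iff.2 ⟨m, hm, rfl⟩))
  exact (hE.properPair hF ha).2.2 ⟨m, hmF, rfl⟩

lemma exists_top_of_irreducible (hA : A.Finite) (hI : IsMonomialIdeal k A I) (hF : IsFace A F)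
    (hE : IsPrimaryExpSet A F (expSet k A I)) (htop : I ≠ ⊤)
    (hirr : ∀ J K : Ideal (SGRing k A), I = J ⊓ K → I = J ∨ I = K) :
    ∃ a ∈ stdSet A (expSet k A I), ∀ x ∈ stdSet A (expSet k A I), FaceDvd A F x a := by
  have h0 : (0 : NSemi A).1 ∈ stdSet A (expSet k A I) :=
    coe_mem_stdSet_iff.2 fun h => htop ((Ideal.eq_top_iff_one I).2 h)
  obtain ⟨a, ha, -, hamax⟩ := hE.exists_maximal hA hF h0
  refine ⟨a, ha, fun x hx => ?_⟩
  obtain ⟨b, hb, hxb, hbmax⟩ := hE.exists_maximal hA hF hx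
  refine hxb.trans ?_
  by_contra hba
  let U : (Fin d → ℤ) → Set (NSemi A) := fun z =>
    {m | mono k A m ∈ I ∨ ∃ q ∈ NSemi A, (m : Fin d → ℤ) = z + q}
  have hU : ∀ z, ∀ s ∈ U z, ∀ c, c + s ∈ U z := by
    rintro z s (hs | ⟨q, hq, hs⟩) c
    · exact .inl (mono_mul_mono (k := k) c s ▸ I.mul_mem_left _ hs)
    · exact .inr ⟨c + q, add_mem c.2 hq, by rw [AddSubmonoid.coe_add, hs]; abel⟩
  let J : (Fin d → ℤ) → Ideal (SGRing k A) := fun z => Ideal.span ((fun m => mono k A m) '' U z)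
  have hJ : ∀ z ∈ stdSet A (expSet k A I), I ≠ J z := by
    intro z hz h
    lift z to NSemi A using hz.1
    refine coe_mem_stdSet_iff.1 hz (h.symm.le ((mono_mem_span_iff (hU z)).2 (.inr ?_)))
    exact ⟨0, zero_mem _, by simp⟩
  have hJinf : I = J a ⊓ J b := by
    ext g
    rw [Ideal.mem_inf, mem_span_mono_image_of_upward (hU a), mem_span_mono_image_of_upward (hU b),
      hI.mem_iff]
    refine ⟨fun h => ⟨fun m hm => .inl (h m hm), fun m hm => .inl (h m hm)⟩,
      fun ⟨h₁, h₂⟩ m hm => ?_⟩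
    obtain h | ⟨q, hq, hmq⟩ := h₁ m hm
    · exact h
    obtain h | ⟨q', hq', hmq'⟩ := h₂ m hm
    · exact h
    by_contra hmI
    refine hba (FaceDvd.trans (b := m) ⟨q', hq', 0, zero_mem _, by simp [hmq']⟩ ?_)
    exact hamax m (coe_mem_stdSet_iff.2 hmI) ⟨q, hq, 0, zero_mem _, by simp [hmq]⟩
  exact (hirr _ _ hJinf).elim (hJ a ha) (hJ b hb)

end Ring


/-- A `p_F`-primary monomial ideal `I` is irreducible if and only if
the standard pairs of `I` whose overlap class is maximal with respect to divisibility
form a single overlap class. -/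
theorem irreducible_iff_single_maximal_overlap_class {d : ℕ} (k : Type*) [Field k]
    (A : Set (Fin d → ℤ)) (hA : IsConfig A)
    (F : Set (Fin d → ℤ)) (hF : IsFace A F)
    (I : Ideal (SGRing k A)) (hI : IsMonomialIdeal k A I)
    (hprimary : I.IsPrimary) (hrad : I.radical = primeF k A F) :
    (I ≠ ⊤ ∧ ∀ J K : Ideal (SGRing k A), I = J ⊓ K → I = J ∨ I = K) ↔
      ((∃ a G, StdPair A (expSet k A I) a G ∧ MaxClass A (expSet k A I) a G) ∧
        ∀ a G b G', StdPair A (expSet k A I) a G → MaxClass A (expSet k A I) a G →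
          StdPair A (expSet k A I) b G' → MaxClass A (expSet k A I) b G' →
          G = G' ∧ Overlap G a b) := by
  have hE := isPrimaryExpSet_expSet hF hprimary hrad
  rw [hE.single_maxClass_iff hA.finite hF]
  constructor
  · exact fun ⟨htop, hirr⟩ => exists_top_of_irreducible hA.finite hI hF hE htop hirr
  · rintro ⟨a, ha, htop⟩
    exact ⟨(Ideal.isPrimary_iff.1 hprimary).1,
      fun J K hJK => irreducible_of_top hI hF hE ha htop hJK⟩

end StdPairsPaper
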